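/- Fix n ≥ 1 and let (C_n, d) be the cochain complex with C_n^k = ⊕_{s ∈ I_k} (ℂ²)^{⊗(n-2k)} (sum over all k-pairings s of n dots) and differential d^k the signed sum of contractions, d^k = ∑_{s ⊂ s'} (-1)^{(s,s')} h_{s',s}. Then C_n is acyclic in non-zero degrees (ker d^k = im d^{k-1} for every k ≥ 1, and d^{⌊n/2⌋} has image covering nothing further, i.e. H^k(C_n) = 0 for k ≠ 0), and its degree-0 cohomology ker d^0 is the subspace of symmetric tensors in (ℂ²)^{⊗n}, an irreducible sl(2, ℂ)-module of dimension n + 1. -/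

import Mathlib

/-! ## Pairings of `n` dots, the complex `C_n`, and its cohomology

Dots are `0, 1, …, n-1` (0-indexed). A `k`-pairing is recorded by the set of
left endpoints `i` of its pairs `{i, i+1}`. The tensor power `(ℂ²)^{⊗(n-2k)}`
attached to a pairing `s` is modelled as the space of coefficient functions
`({single dots of s} → Fin 2) → ℂ`, and `(ℂ²)^{⊗n}` as `(Fin n → Fin 2) → ℂ`. -/

/-- `s` is (the set of left endpoints of) a `k`-pairing of `n` dots. -/
def IsPairing (n k : ℕ) (s : Finset ℕ) : Prop :=
  s ⊆ Finset.range (n - 1) ∧ s.card = k ∧ ∀ i ∈ s, i + 1 ∉ s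

/-- The single (unpaired) dots of a pairing `s` of `n` dots. -/
def singles (n : ℕ) (s : Finset ℕ) : Finset ℕ :=
  (Finset.range n).filter (fun j => j ∉ s ∧ ∀ i ∈ s, j ≠ i + 1)

/-- The tensor product `V^s` of copies of `V = ℂ²` indexed by the single dots
of `s` (in increasing order), as a space of coefficient functions. -/
abbrev TensorV (n : ℕ) (s : Finset ℕ) : Type :=
  ({j // j ∈ singles n s} → Fin 2) → ℂ

lemma mem_singles_of_erase {n m : ℕ} {s : Finset ℕ} {j : ℕ}
    (hj : j ∈ singles n (s.erase m)) (h1 : j ≠ m) (h2 : j ≠ m + 1) :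
    j ∈ singles n s := by
  simp only [singles, Finset.mem_filter, Finset.mem_range, Finset.mem_erase] at hj ⊢
  obtain ⟨hjn, hjs, hall⟩ := hj
  exact ⟨hjn, fun hs => hjs ⟨h1, hs⟩, fun i hi => by
    by_cases him : i = m
    · subst him; exact h2
    · exact hall i ⟨him, hi⟩⟩

/-- Extension of a multi-index on the single dots of `s` to a multi-index on
the single dots of `s.erase m`, putting `x` at dot `m` and `y` at dot `m+1`. -/
def extendAt (n m : ℕ) (s : Finset ℕ) (x y : Fin 2)
    (b : {j // j ∈ singles n s} → Fin 2) : {j // j ∈ singles n (s.erase m)} → Fin 2 :=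
  fun j => if h1 : j.val = m then x else if h2 : j.val = m + 1 then y
    else b ⟨j.val, mem_singles_of_erase j.2 h1 h2⟩

/-- The contraction `h_{s,s \ {m}} : V^{s.erase m} → V^{s}` applying the
determinant form `ω(v,w) = v₁w₂ - v₂w₁` to the two adjacent tensor factors
(dots `m` and `m+1`) forming the new pair. -/
def contractAt (n m : ℕ) (s : Finset ℕ) (T : TensorV n (s.erase m)) :
    TensorV n s :=
  fun b => T (extendAt n m s 0 1 b) - T (extendAt n m s 1 0 b)

/-- The `k`-th term `C_n^k = ⊕_{s ∈ I_k} V^s` of the complex `C_n`. -/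
abbrev ChainC (n k : ℕ) : Type :=
  ∀ s : {s : Finset ℕ // IsPairing n k s}, TensorV n s.val

lemma erase_isPairing {n k : ℕ} {s : Finset ℕ} (hs : IsPairing n (k + 1) s)
    {m : ℕ} (hm : m ∈ s) : IsPairing n k (s.erase m) :=
  ⟨fun i hi => hs.1 (Finset.mem_of_mem_erase hi),
   by rw [Finset.card_erase_of_mem hm, hs.2.1]; rfl,
   fun i hi hc => hs.2.2 i (Finset.mem_of_mem_erase hi) (Finset.mem_of_mem_erase hc)⟩

/-- The differential `d^k : C_n^k → C_n^{k+1}`, the signed sum of contractions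
`(-1)^{(s,s')} h_{s',s}` over all inclusions of pairings `s ⊂ s'`, where
`(s,s')` is the number of pairs of `s` lying entirely to the left of the new
pair of `s'`. -/
noncomputable def chainD (n k : ℕ) (f : ChainC n k) : ChainC n (k + 1) :=
  fun s' b => ∑ m ∈ s'.val.attach,
    (-1 : ℂ) ^ (((s'.val.erase m.val).filter (fun i => i + 1 < m.val)).card) *
      contractAt n m.val s'.val (f ⟨s'.val.erase m.val, erase_isPairing s'.2 m.2⟩) b

lemma mem_singles_of_card_zero {n : ℕ} {s : Finset ℕ} (hs : IsPairing n 0 s)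
    {i : ℕ} (hi : i < n) : i ∈ singles n s := by
  have h : s = ∅ := Finset.card_eq_zero.mp hs.2.1
  subst h
  simp [singles, hi]

/-- The canonical identification of `(ℂ²)^{⊗n}` with the degree-`0` term
`C_n^0` of the complex (the only `0`-pairing is the empty one, all of whose
dots are single). -/
def toC0 (n : ℕ) (T : (Fin n → Fin 2) → ℂ) : ChainC n 0 :=
  fun s b => T (fun i => b ⟨i.val, mem_singles_of_card_zero s.2 i.isLt⟩)

/-- The action of a permutation `σ ∈ Sₙ` on `(ℂ²)^{⊗n}`, permuting tensor
factors. -/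
def permMap (n : ℕ) (σ : Equiv.Perm (Fin n)) :
    ((Fin n → Fin 2) → ℂ) →ₗ[ℂ] ((Fin n → Fin 2) → ℂ) where
  toFun T := fun a => T (a ∘ σ)
  map_add' _ _ := rfl
  map_smul' _ _ := rfl

/-- The subspace of symmetric tensors in `(ℂ²)^{⊗n}`. -/
noncomputable def symmTensors (n : ℕ) : Submodule ℂ ((Fin n → Fin 2) → ℂ) :=
  ⨅ σ : Equiv.Perm (Fin n), LinearMap.ker (permMap n σ - LinearMap.id)

/-- The diagonal (Leibniz-rule) action of a `2×2` matrix `x` on `(ℂ²)^{⊗n}`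
induced by the defining action on `ℂ²`; restricting to traceless `x` gives
the `sl(2,ℂ)`-action. -/
noncomputable def rho (n : ℕ) (x : Matrix (Fin 2) (Fin 2) ℂ)
    (T : (Fin n → Fin 2) → ℂ) : (Fin n → Fin 2) → ℂ :=
  fun b => ∑ i : Fin n, ∑ c : Fin 2, x (b i) c * T (Function.update b i c)

/-- The weight of a multi-index: the number of its entries equal to `1`. -/
def weight {n : ℕ} (a : Fin n → Fin 2) : ℕ := ∑ i, (a i : ℕ)

lemma weight_eq_card {n : ℕ} (a : Fin n → Fin 2) :
    weight a = Fintype.card {i // a i = 1} := by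
  rw [weight, Fintype.card_subtype, Finset.card_filter]
  refine Finset.sum_congr rfl fun i _ => ?_
  generalize a i = x
  fin_cases x <;> rfl

lemma weight_le {n : ℕ} (a : Fin n → Fin 2) : weight a ≤ n := by
  rw [weight_eq_card]
  simpa using Fintype.card_subtype_le (fun i => a i = 1)

lemma weight_comp_perm {n : ℕ} (a : Fin n → Fin 2) (σ : Equiv.Perm (Fin n)) :
    weight (a ∘ σ) = weight a :=
  Equiv.sum_comp σ fun i => (a i : ℕ)

/-- The multi-index of length `n` starting with `w` ones. -/
def sortedIndex (n w : ℕ) : Fin n → Fin 2 := fun i => if (i : ℕ) < w then 1 else 0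

lemma weight_sortedIndex {n w : ℕ} (hw : w ≤ n) : weight (sortedIndex n w) = w := by
  have h : weight (sortedIndex n w) = ∑ i ∈ Finset.range n, if i < w then 1 else 0 := by
    rw [weight, Finset.sum_range]
    refine Finset.sum_congr rfl fun i _ => ?_
    unfold sortedIndex
    split_ifs <;> rfl
  rw [h, ← Finset.card_filter]
  have h' : (Finset.range n).filter (· < w) = Finset.range w := by
    ext i; simp only [Finset.mem_filter, Finset.mem_range]; omega
  rw [h', Finset.card_range]

lemma exists_perm_of_weight_eq {n : ℕ} {a b : Fin n → Fin 2} (h : weight a = weight b) :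
    ∃ σ : Equiv.Perm (Fin n), a = b ∘ σ := by
  rw [weight_eq_card, weight_eq_card] at h
  let e := Fintype.equivOfCardEq h
  refine ⟨e.extendSubtype, funext fun i => ?_⟩
  by_cases hi : a i = 1
  · rw [Function.comp_apply, e.extendSubtype_mem i hi, hi]
  · have := e.extendSubtype_not_mem i hi
    simp only [Function.comp_apply]
    omega

lemma mem_symmTensors {n : ℕ} {T : (Fin n → Fin 2) → ℂ} :
    T ∈ symmTensors n ↔ ∀ (σ : Equiv.Perm (Fin n)) a, T (a ∘ σ) = T a := by
  simp only [symmTensors, Submodule.mem_iInf, LinearMap.mem_ker, LinearMap.sub_apply,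
    sub_eq_zero, LinearMap.id_apply, funext_iff]
  rfl

lemma apply_eq_of_weight_eq {n : ℕ} {T : (Fin n → Fin 2) → ℂ} (hT : T ∈ symmTensors n)
    {a b : Fin n → Fin 2} (h : weight a = weight b) : T a = T b := by
  obtain ⟨σ, rfl⟩ := exists_perm_of_weight_eq h
  exact mem_symmTensors.1 hT σ b

/-- Invariance under adjacent transpositions implies symmetry. -/
lemma mem_symmTensors_of_adjacent {n : ℕ} {T : (Fin n → Fin 2) → ℂ}
    (h : ∀ i j : Fin n, (j : ℕ) = i + 1 → ∀ a, a i = 0 → a j = 1 →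
      T (a ∘ Equiv.swap i j) = T a) : T ∈ symmTensors n := by
  rw [mem_symmTensors]
  have h' : ∀ i j : Fin n, (j : ℕ) = i + 1 → ∀ a, T (a ∘ Equiv.swap i j) = T a := by
    intro i j hij a
    by_cases hij' : a i = a j
    · congr 1
      funext x
      rw [Function.comp_apply, Equiv.swap_apply_def]
      split_ifs with h₁ h₂
      · rw [h₁, hij']
      · rw [h₂, hij']
      · rfl
    by_cases hi : a i = 0
    · exact h i j hij a hi (by omega)
    · have := h i j hij (a ∘ Equiv.swap i j) (by simp; omega) (by simp; omega)
      rw [← this, Function.comp_assoc]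
      congr 1
      ext x
      simp
  cases n with
  | zero => intro σ a; congr 1; exact Subsingleton.elim _ _
  | succ n =>
    intro σ
    have hσ : σ ∈ Submonoid.closure
        (Set.range fun i : Fin n => Equiv.swap i.castSucc i.succ) := by
      rw [Equiv.Perm.mclosure_swap_castSucc_succ]; trivial
    induction hσ using Submonoid.closure_induction with
    | mem x hx =>
      obtain ⟨i, rfl⟩ := hx
      exact h' _ _ (by simp)
    | one => intro a; rfl
    | mul x y _ _ hx hy =>
      intro a
      rw [Equiv.Perm.coe_mul, ← Function.comp_assoc, hy, hx]

/-- The symmetric tensor whose coefficient at a multi-index of weight `w` is `t w`. -/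
def ofWeight (n : ℕ) : (ℕ → ℂ) →ₗ[ℂ] ((Fin n → Fin 2) → ℂ) where
  toFun t a := t (weight a)
  map_add' _ _ := rfl
  map_smul' _ _ := rfl

lemma ofWeight_apply {n : ℕ} (t : ℕ → ℂ) (a : Fin n → Fin 2) :
    ofWeight n t a = t (weight a) := rfl

lemma ofWeight_congr {n : ℕ} {t u : ℕ → ℂ} (h : ∀ w ≤ n, t w = u w) :
    ofWeight n t = ofWeight n u :=
  funext fun a => h _ (weight_le a)

lemma ofWeight_mem {n : ℕ} (t : ℕ → ℂ) : ofWeight n t ∈ symmTensors n :=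
  mem_symmTensors.2 fun σ a => by rw [ofWeight_apply, weight_comp_perm, ofWeight_apply]

lemma eq_ofWeight {n : ℕ} {T : (Fin n → Fin 2) → ℂ} (hT : T ∈ symmTensors n) :
    T = ofWeight n fun w => T (sortedIndex n w) :=
  funext fun a => apply_eq_of_weight_eq hT (weight_sortedIndex (weight_le a)).symm

lemma range_ofWeight (n : ℕ) : LinearMap.range (ofWeight n) = symmTensors n := by
  ext T
  exact ⟨by rintro ⟨t, rfl⟩; exact ofWeight_mem t, fun hT => ⟨_, (eq_ofWeight hT).symm⟩⟩

lemma finrank_symmTensors (n : ℕ) : Module.finrank ℂ (symmTensors n) = n + 1 := by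
  let ext : (Fin (n + 1) → ℂ) →ₗ[ℂ] (ℕ → ℂ) :=
    { toFun := fun t w => t (Fin.ofNat (n + 1) w)
      map_add' := fun _ _ => rfl
      map_smul' := fun _ _ => rfl }
  have hinj : Function.Injective (ofWeight n ∘ₗ ext) := by
    intro t u h
    funext w
    have := congrFun h (sortedIndex n w)
    simpa [ofWeight_apply, weight_sortedIndex (Nat.lt_succ_iff.1 w.2), ext] using this
  have hrange : LinearMap.range (ofWeight n ∘ₗ ext) = symmTensors n := by
    rw [← range_ofWeight]
    refine le_antisymm (LinearMap.range_comp_le_range _ _) ?_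
    rintro _ ⟨t, rfl⟩
    refine ⟨fun w => t w, ?_⟩
    rw [LinearMap.comp_apply]
    refine ofWeight_congr fun w hw => ?_
    change t (w % (n + 1)) = t w
    rw [Nat.mod_eq_of_lt (by omega)]
  rw [← hrange, LinearMap.finrank_range_of_inj hinj, Module.finrank_fin_fun]

lemma rho_mem_symmTensors {n : ℕ} (x : Matrix (Fin 2) (Fin 2) ℂ)
    {T : (Fin n → Fin 2) → ℂ} (hT : T ∈ symmTensors n) : rho n x T ∈ symmTensors n := by
  rw [mem_symmTensors] at hT ⊢
  intro σ b
  simp only [rho]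
  rw [← Equiv.sum_comp σ fun i => ∑ c : Fin 2, x (b i) c * T (Function.update b i c)]
  refine Finset.sum_congr rfl fun i _ => Finset.sum_congr rfl fun c _ => ?_
  rw [← hT σ (Function.update b (σ i) c), Function.update_comp_equiv, Equiv.symm_apply_apply]
  rfl

lemma weight_update_add {n : ℕ} (b : Fin n → Fin 2) (i : Fin n) (c : Fin 2) :
    weight (Function.update b i c) + (b i : ℕ) = weight b + (c : ℕ) := by
  unfold weight
  rw [← Finset.add_sum_erase _ _ (Finset.mem_univ i),
    ← Finset.add_sum_erase _ (fun i => (b i : ℕ)) (Finset.mem_univ i)]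
  have : ∑ j ∈ Finset.univ.erase i, (Function.update b i c j : ℕ)
      = ∑ j ∈ Finset.univ.erase i, (b j : ℕ) :=
    Finset.sum_congr rfl fun j hj => by
      rw [Function.update_of_ne (Finset.ne_of_mem_erase hj)]
  rw [this, Function.update_self]
  ring

lemma rho_raise_ofWeight {n : ℕ} (t : ℕ → ℂ) :
    rho n !![0, 1; 0, 0] (ofWeight n t) = ofWeight n fun w => (n - w) * t (w + 1) := by
  funext b
  have key : ∀ i, ∑ c : Fin 2, (!![0, 1; 0, 0] : Matrix (Fin 2) (Fin 2) ℂ) (b i) c *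
      ofWeight n t (Function.update b i c) = (1 - ((b i : ℕ) : ℂ)) * t (weight b + 1) := by
    intro i
    have h := weight_update_add b i 1
    rw [Fin.sum_univ_two, ofWeight_apply, ofWeight_apply]
    obtain hb | hb : b i = 0 ∨ b i = 1 := by omega
    · simp only [hb, Fin.val_zero, Fin.val_one, add_zero] at h
      simp [hb, h]
    · simp [hb]
  rw [rho, Finset.sum_congr rfl fun i _ => key i, ← Finset.sum_mul, ofWeight_apply]
  simp [weight]

lemma rho_lower_ofWeight {n : ℕ} (t : ℕ → ℂ) :
    rho n !![0, 0; 1, 0] (ofWeight n t) = ofWeight n fun w => w * t (w - 1) := by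
  funext b
  have key : ∀ i, ∑ c : Fin 2, (!![0, 0; 1, 0] : Matrix (Fin 2) (Fin 2) ℂ) (b i) c *
      ofWeight n t (Function.update b i c) = ((b i : ℕ) : ℂ) * t (weight b - 1) := by
    intro i
    have h := weight_update_add b i 0
    rw [Fin.sum_univ_two, ofWeight_apply, ofWeight_apply]
    obtain hb | hb : b i = 0 ∨ b i = 1 := by omega
    · simp [hb]
    · simp only [hb, Fin.val_zero, Fin.val_one, add_zero] at h
      simp [hb, ← h]
  rw [rho, Finset.sum_congr rfl fun i _ => key i, ← Finset.sum_mul, ofWeight_apply]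
  simp [weight]

lemma ofWeight_single_zero_mem {n : ℕ} {W : Submodule ℂ ((Fin n → Fin 2) → ℂ)}
    (hW : ∀ T ∈ W, rho n !![0, 1; 0, 0] T ∈ W) (w₀ : ℕ) (hw₀ : w₀ ≤ n) (t : ℕ → ℂ)
    (ht : t w₀ ≠ 0) (hmax : ∀ w ≤ n, w₀ < w → t w = 0) (hmem : ofWeight n t ∈ W) :
    ofWeight n (Pi.single 0 1) ∈ W := by
  induction w₀ generalizing t with
  | zero =>
    have : ofWeight n (Pi.single 0 1) = (t 0)⁻¹ • ofWeight n t := by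
      rw [← map_smul]
      refine ofWeight_congr fun w hw => ?_
      rcases Nat.eq_zero_or_pos w with rfl | hpos
      · simp [ht]
      · simp [hmax w hw hpos, hpos.ne']
    rw [this]
    exact W.smul_mem _ hmem
  | succ w₀ ih =>
    refine ih (by omega) _ ?_ ?_ (rho_raise_ofWeight t ▸ hW _ hmem)
    · refine mul_ne_zero (sub_ne_zero.2 ?_) ht
      exact_mod_cast (by omega : n ≠ w₀)
    · intro w hw hlt
      rcases hw.eq_or_lt with rfl | hlt'
      · simp
      · rw [hmax (w + 1) hlt' (by omega), mul_zero]

lemma ofWeight_single_mem {n : ℕ} {W : Submodule ℂ ((Fin n → Fin 2) → ℂ)}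
    (hW : ∀ T ∈ W, rho n !![0, 0; 1, 0] T ∈ W)
    (hmem : ofWeight n (Pi.single 0 1) ∈ W) (w : ℕ) : ofWeight n (Pi.single w 1) ∈ W := by
  induction w with
  | zero => exact hmem
  | succ w ih =>
    have h := hW _ ih
    rw [rho_lower_ofWeight] at h
    have : ofWeight n (Pi.single (w + 1) 1) = ((w : ℂ) + 1)⁻¹ •
        ofWeight n fun v => v * (Pi.single w 1 : ℕ → ℂ) (v - 1) := by
      rw [← map_smul]
      refine ofWeight_congr fun v _ => ?_
      rcases v with _ | v
      · simp
      · by_cases hv : v = w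
        · subst hv
          simp [Nat.cast_add_one_ne_zero v]
        · simp [hv]
    rw [this]
    exact W.smul_mem _ h

/-- A nonzero subspace of the symmetric tensors stable under the raising and the lowering
operator contains all symmetric tensors. -/
lemma symmTensors_irreducible {n : ℕ} {W : Submodule ℂ ((Fin n → Fin 2) → ℂ)}
    (hle : W ≤ symmTensors n) (hraise : ∀ T ∈ W, rho n !![0, 1; 0, 0] T ∈ W)
    (hlower : ∀ T ∈ W, rho n !![0, 0; 1, 0] T ∈ W) : W = ⊥ ∨ W = symmTensors n := by
  refine or_iff_not_imp_left.2 fun hbot => le_antisymm hle ?_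
  obtain ⟨T, hTW, hT0⟩ := (Submodule.ne_bot_iff W).1 hbot
  obtain ⟨t, rfl⟩ : ∃ t, ofWeight n t = T := ⟨_, (eq_ofWeight (hle hTW)).symm⟩
  have hne : ((Finset.range (n + 1)).filter (t · ≠ 0)).Nonempty := by
    by_contra hempty
    refine hT0 (Eq.trans (ofWeight_congr (u := 0) fun w hw => ?_) (map_zero _))
    by_contra hw0
    exact hempty ⟨w, Finset.mem_filter.2 ⟨Finset.mem_range.2 (by omega), hw0⟩⟩
  obtain ⟨w₀, hw₀, hmax⟩ := Finset.exists_max_image _ id hne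
  rw [Finset.mem_filter, Finset.mem_range] at hw₀
  have hzero := ofWeight_single_zero_mem hraise w₀ (by omega) t hw₀.2 (fun w hw hlt => by
    by_contra hw0
    exact absurd (hmax w (Finset.mem_filter.2 ⟨Finset.mem_range.2 (by omega), hw0⟩))
      (not_le.2 hlt)) hTW
  rw [← range_ofWeight]
  rintro _ ⟨u, rfl⟩
  have : ofWeight n u = ∑ w ∈ Finset.range (n + 1), u w • ofWeight n (Pi.single w 1) := by
    simp_rw [← map_smul, ← map_sum]
    refine ofWeight_congr fun v hv => ?_
    simp only [Finset.sum_apply, Pi.smul_apply, Pi.single_apply, smul_eq_mul, mul_ite, mul_one,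
      mul_zero, Finset.sum_ite_eq, Finset.mem_range]
    rw [if_pos (by omega)]
  rw [this]
  exact W.sum_mem fun w _ => W.smul_mem _ (ofWeight_single_mem hlower hzero w)

/-- The multi-index `a` with its entries at `m` and `m + 1` replaced by `x` and `y`. -/
def setPair (a : ℕ → Fin 2) (m : ℕ) (x y : Fin 2) : ℕ → Fin 2 :=
  fun j => if j = m then x else if j = m + 1 then y else a j

lemma setPair_of_ne (a : ℕ → Fin 2) {m j : ℕ} (x y : Fin 2) (h₁ : j ≠ m) (h₂ : j ≠ m + 1) :
    setPair a m x y j = a j := by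
  rw [setPair, if_neg h₁, if_neg h₂]

lemma setPair_comm (a : ℕ → Fin 2) {m l : ℕ} (h : m + 1 < l) (x y z w : Fin 2) :
    setPair (setPair a m x y) l z w = setPair (setPair a l z w) m x y := by
  funext j
  unfold setPair
  split_ifs <;> first | rfl | omega

lemma setPair_update (a : ℕ → Fin 2) {m l : ℕ} (h : m + 1 < l) (x y c : Fin 2) :
    setPair (Function.update a l c) m x y = Function.update (setPair a m x y) l c := by
  funext j
  unfold setPair
  rw [Function.update_apply, Function.update_apply]
  split_ifs <;> first | rfl | omega

/-- Restriction of a multi-index on `ℕ` to the first `n` dots. -/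
def restrictIndex (n : ℕ) (a : ℕ → Fin 2) : Fin n → Fin 2 := fun i => a i

lemma weight_restrictIndex_setPair {n m : ℕ} (hm : m + 1 < n) (a : ℕ → Fin 2) :
    weight (restrictIndex n (setPair a m 0 1)) = weight (restrictIndex n (setPair a m 1 0)) := by
  rw [← weight_comp_perm _ (Equiv.swap ⟨m, by omega⟩ ⟨m + 1, hm⟩)]
  congr 1
  funext i
  simp only [Function.comp_apply, Equiv.swap_apply_def, Fin.ext_iff, restrictIndex, setPair]
  split_ifs <;> first | rfl | simp_all

lemma mem_symmTensors_iff_setPair {n : ℕ} {T : (Fin n → Fin 2) → ℂ} :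
    T ∈ symmTensors n ↔ ∀ m, m + 1 < n → ∀ a,
      T (restrictIndex n (setPair a m 0 1)) = T (restrictIndex n (setPair a m 1 0)) := by
  refine ⟨fun hT m hm a => apply_eq_of_weight_eq hT (weight_restrictIndex_setPair hm a),
    fun h => mem_symmTensors_of_adjacent fun i j hij b hi hj => ?_⟩
  have hb := h i (hij ▸ j.2) fun l => if hl : l < n then b ⟨l, hl⟩ else 0
  convert hb.symm using 2
  · funext l
    simp only [Function.comp_apply, Equiv.swap_apply_def, Fin.ext_iff, restrictIndex, setPair, hij]
    split_ifs with h₁ h₂ h₃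
    · exact congrArg Fin.val hj
    · exact congrArg Fin.val hi
    · rfl
    · exact absurd l.2 h₃
  · funext l
    simp only [restrictIndex, setPair]
    split_ifs with h₁ h₂ h₃
    · rw [← hi]; congr 1; exact Fin.ext h₁
    · rw [← hj]; congr 1; exact Fin.ext (h₂.trans hij.symm)
    · rfl
    · exact absurd l.2 h₃

/-- Contraction of the tensor factors at the dots `m` and `m + 1`. -/
def contr (m : ℕ) (F : (ℕ → Fin 2) → ℂ) : (ℕ → Fin 2) → ℂ :=
  fun a => F (setPair a m 0 1) - F (setPair a m 1 0)

/-- The differential `chainD` on cochains whose multi-indices are extended to all of `ℕ`. -/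
noncomputable def extD (F : Finset ℕ → (ℕ → Fin 2) → ℂ) (s : Finset ℕ) (a : ℕ → Fin 2) : ℂ :=
  ∑ m ∈ s, (-1 : ℂ) ^ ((s.erase m).filter (fun i => i + 1 < m)).card * contr m (F (s.erase m)) a

lemma extD_congr {F F' : Finset ℕ → (ℕ → Fin 2) → ℂ} {s : Finset ℕ}
    (h : ∀ m ∈ s, F (s.erase m) = F' (s.erase m)) : extD F s = extD F' s :=
  funext fun _ => Finset.sum_congr rfl fun m hm => by rw [h m hm]

lemma extD_add (F F' : Finset ℕ → (ℕ → Fin 2) → ℂ) (s : Finset ℕ) (a : ℕ → Fin 2) :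
    extD (F + F') s a = extD F s a + extD F' s a := by
  rw [extD, extD, extD, ← Finset.sum_add_distrib]
  refine Finset.sum_congr rfl fun m _ => ?_
  simp only [contr, Pi.add_apply]
  ring

lemma extD_smul (c : ℂ) (F : Finset ℕ → (ℕ → Fin 2) → ℂ) (s : Finset ℕ) (a : ℕ → Fin 2) :
    extD (c • F) s a = c * extD F s a := by
  rw [extD, extD, Finset.mul_sum]
  refine Finset.sum_congr rfl fun m _ => ?_
  simp only [contr, Pi.smul_apply, smul_eq_mul]
  ring

lemma extD_singleton (F : Finset ℕ → (ℕ → Fin 2) → ℂ) (m : ℕ) (a : ℕ → Fin 2) :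
    extD F {m} a = contr m (F ∅) a := by
  simp [extD]

lemma extD_insert (F : Finset ℕ → (ℕ → Fin 2) → ℂ) {n : ℕ} {s : Finset ℕ}
    (hs : ∀ i ∈ s, i + 1 < n) (a : ℕ → Fin 2) :
    extD F (insert n s) a =
      extD (fun t => F (insert n t)) s a + (-1) ^ s.card * contr n (F s) a := by
  have hn : n ∉ s := fun h => by have := hs n h; omega
  rw [extD, Finset.sum_insert hn, Finset.erase_insert hn, Finset.filter_true_of_mem hs, add_comm]
  congr 1
  refine Finset.sum_congr rfl fun m hm => ?_
  have hmn := hs m hm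
  rw [Finset.erase_insert_of_ne (by omega), Finset.filter_insert, if_neg (by omega)]

lemma contr_extD (F : Finset ℕ → (ℕ → Fin 2) → ℂ) {n : ℕ} {s : Finset ℕ}
    (hs : ∀ i ∈ s, i + 1 < n) (a : ℕ → Fin 2) :
    contr n (extD F s) a = extD (fun t => contr n (F t)) s a := by
  rw [contr, extD, extD, extD, ← Finset.sum_sub_distrib]
  refine Finset.sum_congr rfl fun m hm => ?_
  simp only [contr, setPair_comm a (hs m hm)]
  ring

lemma extD_update (F : Finset ℕ → (ℕ → Fin 2) → ℂ) {l : ℕ} {s : Finset ℕ}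
    (hs : ∀ i ∈ s, i + 1 < l) (a : ℕ → Fin 2) (c : Fin 2) :
    extD F s (Function.update a l c) = extD (fun t b => F t (Function.update b l c)) s a := by
  refine Finset.sum_congr rfl fun m hm => ?_
  simp only [contr, setPair_update a (hs m hm)]

lemma extD_glue (G : Fin 2 → Finset ℕ → (ℕ → Fin 2) → ℂ) {l : ℕ} {s : Finset ℕ}
    (hs : ∀ i ∈ s, i + 1 < l) (a : ℕ → Fin 2) :
    extD (fun t b => G (b l) t b) s a = extD (G (a l)) s a := by
  refine Finset.sum_congr rfl fun m hm => ?_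
  have := hs m hm
  simp only [contr, setPair_of_ne a _ _ (show l ≠ m by omega) (show l ≠ m + 1 by omega)]

lemma mem_singles {n j : ℕ} {s : Finset ℕ} :
    j ∈ singles n s ↔ j < n ∧ j ∉ s ∧ ∀ i ∈ s, j ≠ i + 1 := by
  rw [singles, Finset.mem_filter, Finset.mem_range]

lemma isPairing_zero {n : ℕ} {s : Finset ℕ} : IsPairing n 0 s ↔ s = ∅ := by
  refine ⟨fun h => Finset.card_eq_zero.1 h.2.1, ?_⟩
  rintro rfl
  simp [IsPairing]

lemma IsPairing.lt {n k i : ℕ} {s : Finset ℕ} (hs : IsPairing n k s) (hi : i ∈ s) :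
    i + 1 < n := by
  have := Finset.mem_range.1 (hs.1 hi)
  omega

lemma isPairing_one_iff {n : ℕ} {s : Finset ℕ} :
    IsPairing n 1 s ↔ ∃ m, m + 1 < n ∧ s = {m} := by
  constructor
  · intro hs
    obtain ⟨m, rfl⟩ := Finset.card_eq_one.1 hs.2.1
    exact ⟨m, hs.lt (Finset.mem_singleton_self m), rfl⟩
  · rintro ⟨m, hm, rfl⟩
    refine ⟨?_, rfl, by simp⟩
    rw [Finset.singleton_subset_iff, Finset.mem_range]
    omega

lemma IsPairing.insert_last {n k : ℕ} {t : Finset ℕ} (ht : IsPairing n k t) :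
    IsPairing (n + 2) (k + 1) (insert n t) := by
  have hn : n ∉ t := fun h => by have := ht.lt h; omega
  refine ⟨fun i hi => ?_, by rw [Finset.card_insert_of_notMem hn, ht.2.1], fun i hi hi' => ?_⟩
  · rw [Finset.mem_range]
    rcases Finset.mem_insert.1 hi with rfl | hi
    · omega
    · have := ht.lt hi
      omega
  · rcases Finset.mem_insert.1 hi with rfl | hi
    · rcases Finset.mem_insert.1 hi' with h | h
      · omega
      · have := ht.lt h
        omega
    · rcases Finset.mem_insert.1 hi' with h | h
      · have := ht.lt hi
        omega
      · exact ht.2.2 i hi h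

lemma IsPairing.mono {n n' k : ℕ} {s : Finset ℕ} (hs : IsPairing n k s) (h : n ≤ n') :
    IsPairing n' k s :=
  ⟨hs.1.trans (Finset.range_subset_range.2 (by omega)), hs.2⟩

lemma IsPairing.of_last_notMem {n k : ℕ} {s : Finset ℕ} (hs : IsPairing (n + 2) k s)
    (hn : n ∉ s) : IsPairing (n + 1) k s := by
  refine ⟨fun i hi => ?_, hs.2⟩
  have := hs.lt hi
  have : i ≠ n := fun h => hn (h ▸ hi)
  rw [Finset.mem_range]
  omega

lemma IsPairing.erase_last {n k : ℕ} {s : Finset ℕ} (hs : IsPairing (n + 2) (k + 1) s)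
    (hn : n ∈ s) : IsPairing n k (s.erase n) := by
  refine ⟨fun i hi => ?_, (erase_isPairing hs hn).2⟩
  obtain ⟨hin, hi⟩ := Finset.mem_erase.1 hi
  have := hs.lt hi
  have : i + 1 ≠ n := fun h => hs.2.2 i hi (h ▸ hn)
  rw [Finset.mem_range]
  omega

/-- `F` is a `k`-cochain of `C_n`: its values depend only on the entries of the multi-index at
single dots. -/
def IsCochain (n k : ℕ) (F : Finset ℕ → (ℕ → Fin 2) → ℂ) : Prop :=
  ∀ s, IsPairing n k s → ∀ a b, (∀ j ∈ singles n s, a j = b j) → F s a = F s b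

/-- Acyclicity of `C_n` in positive degrees, for cochains with extended multi-indices. -/
def IsAcyclic (n : ℕ) : Prop :=
  ∀ k F, IsCochain n (k + 1) F → (∀ s, IsPairing n (k + 2) s → ∀ a, extD F s a = 0) →
    ∃ G, IsCochain n k G ∧ ∀ s, IsPairing n (k + 1) s → ∀ a, extD G s a = F s a

lemma IsCochain.exists_symm {n : ℕ} {H : Finset ℕ → (ℕ → Fin 2) → ℂ} (hH : IsCochain n 0 H)
    (hd : ∀ t, IsPairing n 1 t → ∀ a, extD H t a = 0) :
    ∃ T ∈ symmTensors n, ∀ a, H ∅ a = T (restrictIndex n a) := by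
  have hrestrict : ∀ a,
      H ∅ a = H ∅ fun j => if hj : j < n then restrictIndex n a ⟨j, hj⟩ else 0 := by
    intro a
    refine hH ∅ (isPairing_zero.2 rfl) _ _ fun j hj => ?_
    rw [dif_pos (mem_singles.1 hj).1]
    rfl
  refine ⟨fun b => H ∅ fun j => if hj : j < n then b ⟨j, hj⟩ else 0, ?_, hrestrict⟩
  refine mem_symmTensors_iff_setPair.2 fun m hm a => ?_
  have := hd {m} (isPairing_one_iff.2 ⟨m, hm, rfl⟩) a
  rw [extD_singleton, contr, sub_eq_zero] at this
  rwa [hrestrict, hrestrict (setPair a m 1 0)] at this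

lemma weight_restrictIndex_succ (n : ℕ) (a : ℕ → Fin 2) :
    weight (restrictIndex (n + 1) a) = weight (restrictIndex n a) + (a n : ℕ) := by
  rw [weight, Fin.sum_univ_castSucc]
  rfl

/-- Surjectivity of the contraction `Sym^{n+1} ⊗ V → Sym^n`. -/
lemma exists_contr_eq_of_symm {n : ℕ} {T : (Fin n → Fin 2) → ℂ} (hT : T ∈ symmTensors n) :
    ∃ G : (ℕ → Fin 2) → ℂ,
      (∀ a a', (∀ j < n + 2, a j = a' j) → G a = G a') ∧
      (∀ m < n, ∀ a, contr m G a = 0) ∧ ∀ a, contr n G a = T (restrictIndex n a) := by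
  refine ⟨fun a => if a (n + 1) = 1 then
    T (sortedIndex n (weight (restrictIndex (n + 1) a))) else 0, ?_, ?_, ?_⟩
  · intro a a' h
    have : restrictIndex (n + 1) a = restrictIndex (n + 1) a' :=
      funext fun i => h i (by omega)
    simp only [h (n + 1) (by omega), this]
  · intro m hm a
    rw [contr, weight_restrictIndex_setPair (by omega),
      setPair_of_ne _ _ _ (by omega) (by omega), setPair_of_ne _ _ _ (by omega) (by omega),
      sub_self]
  · intro a
    have h : restrictIndex n (setPair a n 0 1) = restrictIndex n a :=
      funext fun i => setPair_of_ne _ _ _ (by omega) (by omega)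
    have h₁ : setPair a n 0 1 n = 0 := by simp [setPair]
    have h₂ : ∀ x y, setPair a n x y (n + 1) = y := by simp [setPair]
    rw [contr, h₂, h₂, if_pos rfl, if_neg (by decide), sub_zero, weight_restrictIndex_succ, h, h₁]
    exact apply_eq_of_weight_eq hT (weight_sortedIndex (weight_le _))

lemma IsAcyclic.exists_correction {n : ℕ} (ih : IsAcyclic n) {k : ℕ}
    {H : Finset ℕ → (ℕ → Fin 2) → ℂ} (hH : IsCochain n k H)
    (hd : ∀ t, IsPairing n (k + 1) t → ∀ a, extD H t a = 0) :
    ∃ G, IsCochain (n + 2) k G ∧ (∀ s, IsPairing (n + 1) (k + 1) s → ∀ a, extD G s a = 0) ∧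
      ∀ t, IsPairing n k t → ∀ a, extD G (insert n t) a = H t a := by
  cases k with
  | zero =>
    obtain ⟨T, hT, hHT⟩ := hH.exists_symm hd
    obtain ⟨G, hG, hzero, hlast⟩ := exists_contr_eq_of_symm hT
    refine ⟨fun _ => G, fun s hs a a' h => hG a a' fun j hj => h j ?_, ?_, ?_⟩
    · rw [isPairing_zero.1 hs, mem_singles]
      simpa using hj
    · intro s hs a
      obtain ⟨m, hm, rfl⟩ := isPairing_one_iff.1 hs
      rw [extD_singleton, hzero m (by omega)]
    · intro t ht a
      rw [isPairing_zero.1 ht, insert_empty_eq, extD_singleton, hlast, hHT]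
  | succ k =>
    obtain ⟨G, hG, hGH⟩ := ih k H hH hd
    refine ⟨fun s => if n ∈ s then G (s.erase n) else 0, fun s hs a a' h => ?_, ?_, ?_⟩
    · by_cases hn : n ∈ s
      · simp only [if_pos hn]
        refine hG _ (hs.erase_last hn) _ _ fun j hj => h j ?_
        obtain ⟨hjn, hjs, hj⟩ := mem_singles.1 hj
        refine mem_singles.2 ⟨by omega, fun hs' => hjs (Finset.mem_erase.2 ⟨by omega, hs'⟩),
          fun i hi => ?_⟩
        by_cases hin : i = n
        · omega
        · exact hj i (Finset.mem_erase.2 ⟨hin, hi⟩)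
      · simp only [if_neg hn]
        rfl
    · intro s hs a
      have hn : n ∉ s := fun h => by have := hs.lt h; omega
      rw [extD_congr (F' := 0) fun m _ => if_neg fun h => hn (Finset.mem_of_mem_erase h)]
      simp [extD, contr]
    · intro t ht a
      have hn : n ∉ t := fun h => by have := ht.lt h; omega
      rw [extD_insert _ (fun i => ht.lt), ← hGH t ht]
      simp only [if_neg hn, Finset.mem_insert_self, if_true]
      rw [extD_congr (F' := G) fun m _ => by
        rw [Finset.erase_insert fun h => hn (Finset.mem_of_mem_erase h)]]
      simp [contr]

lemma IsAcyclic.step {n : ℕ} (ih : IsAcyclic n) (ih' : IsAcyclic (n + 1)) :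
    IsAcyclic (n + 2) := by
  intro k F hF hd
  have hlift : ∀ c : Fin 2, ∃ G, IsCochain (n + 1) k G ∧ ∀ s, IsPairing (n + 1) (k + 1) s →
      ∀ a, extD G s a = F s (Function.update a (n + 1) c) := by
    intro c
    refine ih' k (fun s a => F s (Function.update a (n + 1) c)) ?_ ?_
    · intro s hs a a' h
      refine hF s (hs.mono (by omega)) _ _ fun j hj => ?_
      by_cases hjn : j = n + 1
      · rw [hjn, Function.update_self, Function.update_self]
      · rw [Function.update_of_ne hjn, Function.update_of_ne hjn]
        rw [mem_singles] at hj
        exact h j (mem_singles.2 ⟨by omega, hj.2⟩)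
    · intro s hs a
      rw [← extD_update F (fun i => hs.lt)]
      exact hd s (hs.mono (by omega)) _
  choose G hG hGF using hlift
  let G₀ : Finset ℕ → (ℕ → Fin 2) → ℂ := fun s a => if n ∈ s then 0 else G (a (n + 1)) s a
  have hG₀ : IsCochain (n + 2) k G₀ := by
    intro s hs a a' h
    by_cases hn : n ∈ s
    · simp only [G₀, if_pos hn]
    · simp only [G₀, if_neg hn]
      have hs' := hs.of_last_notMem hn
      rw [h (n + 1) (mem_singles.2 ⟨by omega, fun h' => by have := hs'.lt h'; omega,
        fun i hi => by have := hs'.lt hi; omega⟩)]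
      refine hG _ s hs' _ _ fun j hj => h j ?_
      rw [mem_singles] at hj
      exact mem_singles.2 ⟨by omega, hj.2⟩
  have hG₀F : ∀ s, IsPairing (n + 1) (k + 1) s → ∀ a, extD G₀ s a = F s a := by
    intro s hs a
    have hn : n ∉ s := fun h => by have := hs.lt h; omega
    rw [extD_congr (F' := fun t b => G (b (n + 1)) t b) fun m _ =>
      funext fun b => if_neg fun h => hn (Finset.mem_of_mem_erase h),
      extD_glue G (fun i => hs.lt), hGF _ s hs, Function.update_eq_self]
  let H : Finset ℕ → (ℕ → Fin 2) → ℂ :=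
    (fun t => F (insert n t)) + (-(-1 : ℂ) ^ k) • fun t => contr n (G₀ t)
  have hH : IsCochain n k H := by
    intro t ht a a' h
    have hins := hF _ ht.insert_last a a' fun j hj => h j (by
      obtain ⟨hjn, hjs, hj⟩ := mem_singles.1 hj
      have := hj n (Finset.mem_insert_self _ _)
      have : j ≠ n := fun h => hjs (h ▸ Finset.mem_insert_self _ _)
      exact mem_singles.2 ⟨by omega, fun h => hjs (Finset.mem_insert_of_mem h),
        fun i hi => hj i (Finset.mem_insert_of_mem hi)⟩)
    have hcontr : ∀ x y, G₀ t (setPair a n x y) = G₀ t (setPair a' n x y) := by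
      intro x y
      refine hG₀ t (ht.mono (by omega)) _ _ fun j hj => ?_
      unfold setPair
      split_ifs with h₁ h₂
      · rfl
      · rfl
      · rw [mem_singles] at hj
        exact h j (mem_singles.2 ⟨by omega, hj.2⟩)
    simp only [H, Pi.add_apply, Pi.smul_apply, contr, hins, hcontr]
  have hHd : ∀ t, IsPairing n (k + 1) t → ∀ a, extD H t a = 0 := by
    intro t ht a
    have hext := hd _ ht.insert_last a
    have hF₀ : extD G₀ t = F t := funext (hG₀F t (ht.mono (by omega)))
    rw [extD_insert F (fun i => ht.lt), ← hF₀, contr_extD G₀ (fun i => ht.lt), ht.2.1] at hext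
    rw [extD_add, extD_smul, ← hext]
    ring
  obtain ⟨G₁, hG₁, hzero, hlast⟩ := ih.exists_correction hH hHd
  refine ⟨G₀ + G₁, fun s hs a a' h => ?_, fun s hs a => ?_⟩
  · simp only [Pi.add_apply, hG₀ s hs a a' h, hG₁ s hs a a' h]
  · rw [extD_add]
    by_cases hn : n ∈ s
    · have ht := hs.erase_last hn
      have hG₀t : extD G₀ s a = (-1) ^ k * contr n (G₀ (s.erase n)) a := by
        conv_lhs => rw [← Finset.insert_erase hn]
        rw [extD_insert G₀ (fun i => ht.lt), ht.2.1, extD_congr (F' := 0) fun m _ =>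
          funext fun b => if_pos (Finset.mem_insert_self _ _)]
        simp [extD, contr]
      have hG₁t := hlast _ ht a
      rw [Finset.insert_erase hn] at hG₁t
      rw [hG₀t, hG₁t]
      simp only [H, Pi.add_apply, Pi.smul_apply, smul_eq_mul, Finset.insert_erase hn]
      ring
    · have hs' := hs.of_last_notMem hn
      rw [hG₀F s hs', hzero s hs', add_zero]

lemma isAcyclic (n : ℕ) : IsAcyclic n := by
  have hsmall : ∀ n ≤ 1, IsAcyclic n := by
    intro n hn k F _ _
    refine ⟨0, fun _ _ _ _ _ => rfl, fun s hs => ?_⟩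
    obtain ⟨i, hi⟩ := Finset.card_pos.1 (hs.2.1 ▸ Nat.succ_pos k : 0 < s.card)
    have := hs.lt hi
    omega
  induction n using Nat.twoStepInduction with
  | zero => exact hsmall 0 (by omega)
  | one => exact hsmall 1 le_rfl
  | more n ih ih₁ => exact ih.step ih₁

/-- Extension of a cochain to multi-indices on all of `ℕ`. -/
noncomputable def extCochain {n k : ℕ} (f : ChainC n k) (s : Finset ℕ) (a : ℕ → Fin 2) : ℂ :=
  open Classical in if h : IsPairing n k s then f ⟨s, h⟩ fun j => a j else 0

lemma extCochain_apply {n k : ℕ} (f : ChainC n k) {s : Finset ℕ} (hs : IsPairing n k s)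
    (a : ℕ → Fin 2) : extCochain f s a = f ⟨s, hs⟩ fun j => a j :=
  dif_pos hs

lemma isCochain_extCochain {n k : ℕ} (f : ChainC n k) : IsCochain n k (extCochain f) := by
  intro s hs a a' h
  rw [extCochain_apply f hs, extCochain_apply f hs]
  exact congrArg _ (funext fun j => h j j.2)

lemma extD_extCochain {n k : ℕ} (f : ChainC n k) {s : Finset ℕ} (hs : IsPairing n (k + 1) s)
    (a : ℕ → Fin 2) : extD (extCochain f) s a = chainD n k f ⟨s, hs⟩ fun j => a j := by
  rw [extD, chainD, ← Finset.sum_attach]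
  refine Finset.sum_congr rfl fun m _ => ?_
  rw [contr, extCochain_apply f (erase_isPairing hs m.2),
    extCochain_apply f (erase_isPairing hs m.2)]
  rfl

/-- Extension by zero of a multi-index on the single dots of `s`. -/
def extIndex {n : ℕ} {s : Finset ℕ} (b : {j // j ∈ singles n s} → Fin 2) : ℕ → Fin 2 :=
  fun j => if h : j ∈ singles n s then b ⟨j, h⟩ else 0

lemma extIndex_coe {n : ℕ} {s : Finset ℕ} (b : {j // j ∈ singles n s} → Fin 2)
    (j : {j // j ∈ singles n s}) : extIndex b j = b j :=
  dif_pos j.2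

lemma chainD_eq_extD {n k : ℕ} (f : ChainC n k) (s : {s : Finset ℕ // IsPairing n (k + 1) s})
    (b : {j // j ∈ singles n s.val} → Fin 2) :
    chainD n k f s b = extD (extCochain f) s.val (extIndex b) := by
  rw [extD_extCochain f s.2]
  exact congrArg _ (funext fun j => (extIndex_coe b j).symm)

lemma exists_chainD_eq {n k : ℕ} (f : ChainC n (k + 1)) (hf : chainD n (k + 1) f = 0) :
    ∃ g : ChainC n k, chainD n k g = f := by
  obtain ⟨G, hG, hGf⟩ := isAcyclic n k (extCochain f) (isCochain_extCochain f)
    fun s hs a => by rw [extD_extCochain f hs, hf]; rfl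
  refine ⟨fun s b => G s.val (extIndex b), ?_⟩
  funext s b
  rw [chainD_eq_extD, extD_congr (F' := G) fun m hm => funext fun a => ?_, hGf s.val s.2,
    extCochain_apply f s.2]
  · exact congrArg _ (funext (extIndex_coe b))
  · have hs := erase_isPairing s.2 hm
    rw [extCochain_apply _ hs]
    exact hG _ hs _ _ fun j hj => extIndex_coe _ ⟨j, hj⟩

lemma toC0_bijective (n : ℕ) : Function.Bijective (toC0 n) := by
  constructor
  · intro T T' h
    funext a
    exact congrFun (congrFun h ⟨∅, isPairing_zero.2 rfl⟩)
      fun j => a ⟨j, (mem_singles.1 j.2).1⟩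
  · intro f
    refine ⟨fun a => f ⟨∅, isPairing_zero.2 rfl⟩ fun j => a ⟨j, (mem_singles.1 j.2).1⟩, ?_⟩
    funext ⟨s, hs⟩ b
    obtain rfl := isPairing_zero.1 hs
    rfl

lemma chainD_toC0_eq_zero_iff {n : ℕ} (T : (Fin n → Fin 2) → ℂ) :
    chainD n 0 (toC0 n T) = 0 ↔ T ∈ symmTensors n := by
  have key : ∀ m a, extD (extCochain (toC0 n T)) {m} a = 0 ↔
      T (restrictIndex n (setPair a m 0 1)) = T (restrictIndex n (setPair a m 1 0)) := by
    intro m a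
    rw [extD_singleton, contr, extCochain_apply _ (isPairing_zero.2 rfl),
      extCochain_apply _ (isPairing_zero.2 rfl), sub_eq_zero]
    rfl
  rw [mem_symmTensors_iff_setPair]
  constructor
  · intro h m hm a
    rw [← key, extD_extCochain _ (isPairing_one_iff.2 ⟨m, hm, rfl⟩), h]
    rfl
  · intro h
    funext s b
    obtain ⟨m, hm, hs⟩ := isPairing_one_iff.1 s.2
    rw [chainD_eq_extD]
    generalize extIndex b = a
    rw [hs, (key m a).2 (h m hm a)]
    rfl

/-- the complex `C_n` is acyclic in non-zero degrees (every
cocycle of positive degree is a coboundary), and its degree-`0` cohomology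
`ker d⁰` is, under the canonical identification `toC0` of `(ℂ²)^{⊗n}` with
`C_n^0`, exactly the subspace of symmetric tensors in `(ℂ²)^{⊗n}` — an
irreducible `sl(2,ℂ)`-module of dimension `n + 1`. -/
theorem complex_Cn_resolution (n : ℕ) (hn : 1 ≤ n) :
    (∀ (k : ℕ) (f : ChainC n (k + 1)), chainD n (k + 1) f = 0 →
      ∃ g : ChainC n k, chainD n k g = f) ∧
    Function.Bijective (toC0 n) ∧
    (∀ T : (Fin n → Fin 2) → ℂ, chainD n 0 (toC0 n T) = 0 ↔ T ∈ symmTensors n) ∧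
    Module.finrank ℂ (symmTensors n) = n + 1 ∧
    symmTensors n ≠ ⊥ ∧
    (∀ x : Matrix (Fin 2) (Fin 2) ℂ, x.trace = 0 →
      ∀ T ∈ symmTensors n, rho n x T ∈ symmTensors n) ∧
    (∀ W : Submodule ℂ ((Fin n → Fin 2) → ℂ), W ≤ symmTensors n →
      (∀ x : Matrix (Fin 2) (Fin 2) ℂ, x.trace = 0 → ∀ T ∈ W, rho n x T ∈ W) →
      W = ⊥ ∨ W = symmTensors n) := by
  refine ⟨fun k f => exists_chainD_eq f, toC0_bijective n, chainD_toC0_eq_zero_iff,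
    finrank_symmTensors n, fun h => ?_, fun x _ T hT => rho_mem_symmTensors x hT,
    fun W hle hW => symmTensors_irreducible hle (hW _ (by simp [Matrix.trace_fin_two]))
      (hW _ (by simp [Matrix.trace_fin_two]))⟩
  have hdim := finrank_symmTensors n
  rw [h, finrank_bot] at hdim
  omega
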